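/- Let ρ be a PSqPO rule consisting of a span of graphs (l : K → L, r : K → R) together with a polarized graph K̂ = (K, N_K⁺, N_K⁻) whose underlying graph is K, and let m : L ↣ G be a monomorphism of graphs. Let 𝕋 be the S-partial map classifier functor of Grpol with unit η, set T_K = |𝕋(K̂)| and t = |η_{K̂}| : K → T_K. Then G rewrites to H via the PSqPO step for ρ at m if and only if G rewrites to H via the AGREE step in Gr for the rule (l, r, t) at m. -/

import Mathlib

open CategoryTheory CategoryTheory.Limits

universe u

/-- A graph: a set of nodes, a set of edges, and source/target functions. -/
structure Grph : Type (u + 1) where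
  N : Type u
  E : Type u
  s : E → N
  t : E → N

/-- A morphism of graphs: functions on nodes and edges commuting with source/target. -/
structure Grph.Hom (X Y : Grph.{u}) : Type u where
  onN : X.N → Y.N
  onE : X.E → Y.E
  map_s : ∀ e, Y.s (onE e) = onN (X.s e)
  map_t : ∀ e, Y.t (onE e) = onN (X.t e)

/-- The category `Gr` of graphs. -/
instance : Category Grph.{u} where
  Hom := Grph.Hom
  id X := ⟨id, id, fun _ => rfl, fun _ => rfl⟩
  comp f g := ⟨g.onN ∘ f.onN, g.onE ∘ f.onE,
    fun e => by simp only [Function.comp_apply, g.map_s, f.map_s],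
    fun e => by simp only [Function.comp_apply, g.map_t, f.map_t]⟩

theorem Grph.Hom.ext' {X Y : Grph.{u}} {f g : X ⟶ Y}
    (h1 : f.onN = g.onN) (h2 : f.onE = g.onE) : f = g := by
  have key : ∀ f g : Grph.Hom X Y, f.onN = g.onN → f.onE = g.onE → f = g := by
    intro f g h1 h2
    cases f; cases g; cases h1; cases h2; rfl
  exact key f g h1 h2

/-- The object part of the partial map classifier of `Gr`: `T(G)` has nodes `N_G ⊔ {*}`
and edges `E_G ⊔ ((N_G ⊔ {*}) × (N_G ⊔ {*}))`, the extra edge indexed by `(n, p)` having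
source `n` and target `p`. -/
def TGrObj (G : Grph.{u}) : Grph.{u} where
  N := Option G.N
  E := G.E ⊕ (Option G.N × Option G.N)
  s := fun e => match e with
    | .inl e => some (G.s e)
    | .inr p => p.1
  t := fun e => match e with
    | .inl e => some (G.t e)
    | .inr p => p.2

/-- The partial map classifier functor `T : Gr ⥤ Gr`. -/
def TGr : Grph.{u} ⥤ Grph.{u} where
  obj := TGrObj
  map {X Y} f :=
    { onN := Option.map f.onN
      onE := Sum.map f.onE (Prod.map (Option.map f.onN) (Option.map f.onN))
      map_s := by rintro (e | ⟨a, b⟩) <;> simp [TGrObj, f.map_s]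
      map_t := by rintro (e | ⟨a, b⟩) <;> simp [TGrObj, f.map_t] }
  map_id X := by
    apply Grph.Hom.ext'
    · funext n; cases n <;> rfl
    · funext e
      rcases e with e | ⟨a, b⟩
      · rfl
      · cases a <;> cases b <;> rfl
  map_comp f g := by
    apply Grph.Hom.ext'
    · funext n; cases n <;> rfl
    · funext e
      rcases e with e | ⟨a, b⟩
      · rfl
      · cases a <;> cases b <;> rfl

/-- The component at `G` of the natural transformation `η : Id ⟶ T`: the evident
inclusion of `G` into `T(G)`. -/
def etaGr (G : Grph.{u}) : G ⟶ TGr.obj G where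
  onN := some
  onE := Sum.inl
  map_s := fun _ => rfl
  map_t := fun _ => rfl

/-- A polarized graph: a graph with subsets `N⁺`, `N⁻` of nodes such that every edge
`n → p` has `n ∈ N⁺` and `p ∈ N⁻`. -/
structure PolGrph : Type (u + 1) where
  N : Type u
  E : Type u
  s : E → N
  t : E → N
  Np : Set N
  Nm : Set N
  s_mem : ∀ e, s e ∈ Np
  t_mem : ∀ e, t e ∈ Nm

/-- A morphism of polarized graphs: a graph morphism preserving both polarities. -/
structure PolGrph.Hom (X Y : PolGrph.{u}) : Type u where
  onN : X.N → Y.N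
  onE : X.E → Y.E
  map_s : ∀ e, Y.s (onE e) = onN (X.s e)
  map_t : ∀ e, Y.t (onE e) = onN (X.t e)
  mapNp : ∀ n ∈ X.Np, onN n ∈ Y.Np
  mapNm : ∀ n ∈ X.Nm, onN n ∈ Y.Nm

/-- The category `Grpol` of polarized graphs. -/
instance : Category PolGrph.{u} where
  Hom := PolGrph.Hom
  id X := ⟨id, id, fun _ => rfl, fun _ => rfl, fun _ h => h, fun _ h => h⟩
  comp f g := ⟨g.onN ∘ f.onN, g.onE ∘ f.onE,
    fun e => by simp only [Function.comp_apply, g.map_s, f.map_s],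
    fun e => by simp only [Function.comp_apply, g.map_t, f.map_t],
    fun n h => g.mapNp _ (f.mapNp n h), fun n h => g.mapNm _ (f.mapNm n h)⟩

theorem PolGrph.Hom.ext' {X Y : PolGrph.{u}} {f g : X ⟶ Y}
    (h1 : f.onN = g.onN) (h2 : f.onE = g.onE) : f = g := by
  have key : ∀ f g : PolGrph.Hom X Y, f.onN = g.onN → f.onE = g.onE → f = g := by
    intro f g h1 h2
    cases f; cases g; cases h1; cases h2; rfl
  exact key f g h1 h2

/-- A morphism of polarized graphs is strict if `f(N_X⁺) = f(N_X) ∩ N_Y⁺` and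
`f(N_X⁻) = f(N_X) ∩ N_Y⁻`. -/
def PolGrph.Hom.Strict {X Y : PolGrph.{u}} (f : X ⟶ Y) : Prop :=
  f.onN '' X.Np = Set.range f.onN ∩ Y.Np ∧ f.onN '' X.Nm = Set.range f.onN ∩ Y.Nm

/-- The stable system `S` of strict monos of `Grpol`. -/
def StrictMonos {X Y : PolGrph.{u}} (f : X ⟶ Y) : Prop :=
  Mono f ∧ PolGrph.Hom.Strict f

/-- The object part of the `S`-partial map classifier of `Grpol`: `𝕋(K̂)` is the disjoint
union of `K̂` with a node `*` of both polarities and an edge `*_{n,p} : n → p` for every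
pair `(n, p) ∈ (N⁺ ⊔ {*}) × (N⁻ ⊔ {*})`. -/
def TPolObj (K : PolGrph.{u}) : PolGrph.{u} where
  N := Option K.N
  E := K.E ⊕ (Option K.Np × Option K.Nm)
  s := fun e => match e with
    | .inl e => some (K.s e)
    | .inr p => Option.map Subtype.val p.1
  t := fun e => match e with
    | .inl e => some (K.t e)
    | .inr p => Option.map Subtype.val p.2
  Np := insert none (some '' K.Np)
  Nm := insert none (some '' K.Nm)
  s_mem := by
    rintro (e | ⟨a, b⟩)
    · exact Set.mem_insert_iff.mpr (Or.inr ⟨_, K.s_mem e, rfl⟩)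
    · cases a with
      | none => exact Set.mem_insert _ _
      | some x => exact Set.mem_insert_iff.mpr (Or.inr ⟨x.1, x.2, rfl⟩)
  t_mem := by
    rintro (e | ⟨a, b⟩)
    · exact Set.mem_insert_iff.mpr (Or.inr ⟨_, K.t_mem e, rfl⟩)
    · cases b with
      | none => exact Set.mem_insert _ _
      | some x => exact Set.mem_insert_iff.mpr (Or.inr ⟨x.1, x.2, rfl⟩)

/-- The component at `K̂` of the unit `η : Id ⟶ 𝕋`: the evident inclusion. -/
def etaPol (K : PolGrph.{u}) : K ⟶ TPolObj K where
  onN := some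
  onE := Sum.inl
  map_s := fun _ => rfl
  map_t := fun _ => rfl
  mapNp := fun n h => Set.mem_insert_iff.mpr (Or.inr ⟨n, h, rfl⟩)
  mapNm := fun n h => Set.mem_insert_iff.mpr (Or.inr ⟨n, h, rfl⟩)

/-- The underlying-graph functor `|·| : Grpol ⥤ Gr`. -/
def forgetPol : PolGrph.{u} ⥤ Grph.{u} where
  obj K := ⟨K.N, K.E, K.s, K.t⟩
  map f := ⟨f.onN, f.onE, f.map_s, f.map_t⟩
  map_id _ := rfl
  map_comp _ _ := rfl

/-- The functor `Pol : Gr ⥤ Grpol`, `Pol(X) = (X, N_X, N_X)`, identity on morphisms. -/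
def PolF : Grph.{u} ⥤ PolGrph.{u} where
  obj X := ⟨X.N, X.E, X.s, X.t, Set.univ, Set.univ,
    fun _ => Set.mem_univ _, fun _ => Set.mem_univ _⟩
  map f := ⟨f.onN, f.onE, f.map_s, f.map_t,
    fun _ _ => Set.mem_univ _, fun _ _ => Set.mem_univ _⟩
  map_id _ := rfl
  map_comp _ _ := rfl

/-- The functor `Pol^± : Gr ⥤ Grpol`: a node is in `N⁺` (resp. `N⁻`) iff it has at least
one outgoing (resp. incoming) edge. -/
def PolPM : Grph.{u} ⥤ PolGrph.{u} where
  obj X := ⟨X.N, X.E, X.s, X.t, {n | ∃ e, X.s e = n}, {n | ∃ e, X.t e = n},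
    fun e => ⟨e, rfl⟩, fun e => ⟨e, rfl⟩⟩
  map f := ⟨f.onN, f.onE, f.map_s, f.map_t,
    fun n hn => by obtain ⟨e, he⟩ := hn; exact ⟨f.onE e, by rw [f.map_s, he]⟩,
    fun n hn => by obtain ⟨e, he⟩ := hn; exact ⟨f.onE e, by rw [f.map_t, he]⟩⟩
  map_id _ := rfl
  map_comp _ _ := rfl

universe w v

/-- `(n, a)` is a final pullback complement of `(l, m)`. -/
def IsFinalPullbackComplement {C : Type w} [Category.{v} C] {K L D G : C}
    (l : K ⟶ L) (m : L ⟶ G) (n : K ⟶ D) (a : D ⟶ G) : Prop :=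
  IsPullback l n m a ∧
  ∀ {K' D' : C} (d : K' ⟶ L) (e : K' ⟶ D') (f : D' ⟶ G) (h : K' ⟶ K),
    IsPullback d e m f → h ≫ l = d →
    ∃! g : D' ⟶ D, g ≫ a = f ∧ e ≫ g = h ≫ n

/-- The unit `u_{K̂} : K̂ ⟶ Pol(|K̂|)` of the adjunction `|·| ⊣ Pol`. -/
def polUnit (K : PolGrph.{u}) : K ⟶ PolF.obj (forgetPol.obj K) :=
  ⟨id, id, fun _ => rfl, fun _ => rfl, fun _ _ => Set.mem_univ _, fun _ _ => Set.mem_univ _⟩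

/-- The PSqPO rewrite step `G ⇒ H` for the rule `((l, r), K̂)` at the match `m`: a final
pullback complement of `(Pol(l) ∘ u_{K̂}, Pol(m))` in `Grpol`, followed in `Gr` by a
pushout of `(|n|, r)`. -/
def PSqpoStep (Khat : PolGrph.{u}) {L R G : Grph.{u}}
    (l : forgetPol.obj Khat ⟶ L) (r : forgetPol.obj Khat ⟶ R) (m : L ⟶ G)
    (H : Grph.{u}) : Prop :=
  ∃ (Dhat : PolGrph.{u}) (n : Khat ⟶ Dhat) (g : Dhat ⟶ PolF.obj G)
    (h : forgetPol.obj Dhat ⟶ H) (p : R ⟶ H),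
    IsFinalPullbackComplement (polUnit Khat ≫ PolF.map l) (PolF.map m) n g ∧
    IsPushout (forgetPol.map n) r h p

/-- The AGREE rewrite step `G ⇒ H` in `Gr` for the rule `(l, r, t : K ↣ T_K)` at the
match `m`, relative to the mono-partial map classifier `(T, η)` of `Gr`: here
`l' = φ(t, l)` and `m̄ = φ(m, id_L)` are characterized as the classifying arrows of the
corresponding partial maps (the unique arrows making the squares below pullbacks). -/
def AgreeStepGr {K L R TK G : Grph.{u}} (l : K ⟶ L) (r : K ⟶ R)
    (t : K ⟶ TK) (m : L ⟶ G) (H : Grph.{u}) : Prop :=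
  ∃ (l' : TK ⟶ TGr.obj L) (mbar : G ⟶ TGr.obj L),
    IsPullback l t (etaGr L) l' ∧ IsPullback (𝟙 L) m (etaGr L) mbar ∧
    ∃ (D : Grph.{u}) (g : D ⟶ G) (n' : D ⟶ TK) (n : K ⟶ D) (h : D ⟶ H) (p : R ⟶ H),
      IsPullback g n' mbar l' ∧ n ≫ n' = t ∧ n ≫ g = l ≫ m ∧ IsPushout n r h p

namespace Grph

theorem congr_onN {X Y : Grph.{u}} {f g : X ⟶ Y} (h : f = g) (x : X.N) :
    f.onN x = g.onN x := by rw [h]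

theorem congr_onE {X Y : Grph.{u}} {f g : X ⟶ Y} (h : f = g) (x : X.E) :
    f.onE x = g.onE x := by rw [h]

/-- The graph with one node and no edge, which represents nodes. -/
def point : Grph.{u} := ⟨PUnit, PEmpty, PEmpty.elim, PEmpty.elim⟩

/-- The graph with a single edge between two distinct nodes, which represents edges. -/
def arrow : Grph.{u} := ⟨ULift Bool, PUnit, fun _ => ⟨false⟩, fun _ => ⟨true⟩⟩

/-- The morphism from the point that picks the node `x`. -/
def ofNode {X : Grph.{u}} (x : X.N) : point ⟶ X :=
  ⟨fun _ => x, fun e => e.elim, fun e => e.elim, fun e => e.elim⟩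

/-- The morphism from the arrow that picks the edge `x`. -/
def ofEdge {X : Grph.{u}} (x : X.E) : arrow ⟶ X :=
  ⟨fun b => cond b.down (X.t x) (X.s x), fun _ => x, fun _ => rfl, fun _ => rfl⟩

theorem ofNode_comp {X Y : Grph.{u}} (x : X.N) (f : X ⟶ Y) :
    ofNode x ≫ f = ofNode (f.onN x) :=
  Grph.Hom.ext' rfl (funext fun e => e.elim)

theorem ofEdge_comp {X Y : Grph.{u}} (x : X.E) (f : X ⟶ Y) :
    ofEdge x ≫ f = ofEdge (f.onE x) := by
  refine Grph.Hom.ext' (funext ?_) rfl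
  rintro ⟨_ | _⟩
  · exact (f.map_s x).symm
  · exact (f.map_t x).symm

/-- Pullbacks of graphs are computed on nodes and on edges. -/
theorem isPullback_iff {P X Y Z : Grph.{u}} {f : P ⟶ X} {g : P ⟶ Y} {h : X ⟶ Z} {k : Y ⟶ Z} :
    IsPullback f g h k ↔ f ≫ h = g ≫ k ∧
      (∀ x y, h.onN x = k.onN y → ∃! p, f.onN p = x ∧ g.onN p = y) ∧
      (∀ x y, h.onE x = k.onE y → ∃! p, f.onE p = x ∧ g.onE p = y) := by
  constructor
  · intro H
    refine ⟨H.w, fun x y hxy => ?_, fun x y hxy => ?_⟩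
    · have w : ofNode x ≫ h = ofNode y ≫ k := by rw [ofNode_comp, ofNode_comp, hxy]
      refine ⟨(H.lift _ _ w).onN PUnit.unit, ⟨congr_onN (H.lift_fst _ _ w) PUnit.unit,
        congr_onN (H.lift_snd _ _ w) PUnit.unit⟩, ?_⟩
      rintro q ⟨rfl, rfl⟩
      have : ofNode q = H.lift _ _ w := H.hom_ext (by rw [ofNode_comp, H.lift_fst])
        (by rw [ofNode_comp, H.lift_snd])
      exact congr_onN this PUnit.unit
    · have w : ofEdge x ≫ h = ofEdge y ≫ k := by rw [ofEdge_comp, ofEdge_comp, hxy]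
      refine ⟨(H.lift _ _ w).onE PUnit.unit, ⟨congr_onE (H.lift_fst _ _ w) PUnit.unit,
        congr_onE (H.lift_snd _ _ w) PUnit.unit⟩, ?_⟩
      rintro q ⟨rfl, rfl⟩
      have : ofEdge q = H.lift _ _ w := H.hom_ext (by rw [ofEdge_comp, H.lift_fst])
        (by rw [ofEdge_comp, H.lift_snd])
      exact congr_onE this PUnit.unit
  · rintro ⟨w, hN, hE⟩
    refine ⟨⟨w⟩, ⟨PullbackCone.IsLimit.mk w (fun s => ?_) ?_ ?_ ?_⟩⟩
    · have cN x := hN _ _ (congr_onN s.condition x)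
      have cE x := hE _ _ (congr_onE s.condition x)
      refine ⟨fun x => (cN x).choose, fun x => (cE x).choose, fun e => ?_, fun e => ?_⟩
      · refine (cN _).unique ⟨?_, ?_⟩ (cN _).choose_spec.1
        · rw [← f.map_s, (cE e).choose_spec.1.1]
          exact s.fst.map_s e
        · rw [← g.map_s, (cE e).choose_spec.1.2]
          exact s.snd.map_s e
      · refine (cN _).unique ⟨?_, ?_⟩ (cN _).choose_spec.1
        · rw [← f.map_t, (cE e).choose_spec.1.1]
          exact s.fst.map_t e
        · rw [← g.map_t, (cE e).choose_spec.1.2]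
          exact s.snd.map_t e
    · intro s
      exact Grph.Hom.ext' (funext fun x => (hN _ _ (congr_onN s.condition x)).choose_spec.1.1)
        (funext fun x => (hE _ _ (congr_onE s.condition x)).choose_spec.1.1)
    · intro s
      exact Grph.Hom.ext' (funext fun x => (hN _ _ (congr_onN s.condition x)).choose_spec.1.2)
        (funext fun x => (hE _ _ (congr_onE s.condition x)).choose_spec.1.2)
    · intro s q h1 h2
      refine Grph.Hom.ext' (funext fun x => ?_) (funext fun x => ?_)
      · exact (hN _ _ (congr_onN s.condition x)).unique ⟨congr_onN h1 x, congr_onN h2 x⟩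
          (hN _ _ (congr_onN s.condition x)).choose_spec.1
      · exact (hE _ _ (congr_onE s.condition x)).unique ⟨congr_onE h1 x, congr_onE h2 x⟩
          (hE _ _ (congr_onE s.condition x)).choose_spec.1

theorem onN_injective {X Y : Grph.{u}} (f : X ⟶ Y) [Mono f] : Function.Injective f.onN := by
  intro x y hxy
  have : ofNode x = ofNode y := (cancel_mono f).1 (by rw [ofNode_comp, ofNode_comp, hxy])
  exact congr_onN this PUnit.unit

theorem onE_injective {X Y : Grph.{u}} (f : X ⟶ Y) [Mono f] : Function.Injective f.onE := by
  intro x y hxy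
  have : ofEdge x = ofEdge y := (cancel_mono f).1 (by rw [ofEdge_comp, ofEdge_comp, hxy])
  exact congr_onE this PUnit.unit

/-- The standard pullback of graphs. -/
theorem exists_isPullback {X Y Z : Grph.{u}} (h : X ⟶ Z) (k : Y ⟶ Z) :
    ∃ (P : Grph.{u}) (f : P ⟶ X) (g : P ⟶ Y), IsPullback f g h k := by
  refine ⟨⟨{p : X.N × Y.N // h.onN p.1 = k.onN p.2}, {p : X.E × Y.E // h.onE p.1 = k.onE p.2},
    fun p => ⟨(X.s p.1.1, Y.s p.1.2), by rw [← h.map_s, ← k.map_s, p.2]⟩,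
    fun p => ⟨(X.t p.1.1, Y.t p.1.2), by rw [← h.map_t, ← k.map_t, p.2]⟩⟩,
    ⟨fun p => p.1.1, fun p => p.1.1, fun _ => rfl, fun _ => rfl⟩,
    ⟨fun p => p.1.2, fun p => p.1.2, fun _ => rfl, fun _ => rfl⟩, isPullback_iff.2 ⟨?_, ?_, ?_⟩⟩
  · exact Grph.Hom.ext' (funext fun p => p.2) (funext fun p => p.2)
  · rintro x y hxy
    refine ⟨⟨(x, y), hxy⟩, ⟨rfl, rfl⟩, ?_⟩
    rintro ⟨⟨x', y'⟩, _⟩ ⟨rfl, rfl⟩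
    rfl
  · rintro x y hxy
    refine ⟨⟨(x, y), hxy⟩, ⟨rfl, rfl⟩, ?_⟩
    rintro ⟨⟨x', y'⟩, _⟩ ⟨rfl, rfl⟩
    rfl

/-- A partial map of graphs has at most one classifying arrow. -/
theorem classifier_unique {K L D : Grph.{u}} {d : K ⟶ L} {e : K ⟶ D} {φ ψ : D ⟶ TGr.obj L}
    (hφ : IsPullback d e (etaGr L) φ) (hψ : IsPullback d e (etaGr L) ψ) : φ = ψ := by
  have onN_le {φ ψ : D ⟶ TGr.obj L} (hφ : IsPullback d e (etaGr L) φ)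
      (hψ : IsPullback d e (etaGr L) ψ) (x : D.N) (y : L.N) (h : φ.onN x = some y) :
      ψ.onN x = some y := by
    obtain ⟨p, ⟨rfl, rfl⟩, -⟩ := (isPullback_iff.1 hφ).2.1 y x h.symm
    exact (congr_onN hψ.w p).symm
  have onE_le {φ ψ : D ⟶ TGr.obj L} (hφ : IsPullback d e (etaGr L) φ)
      (hψ : IsPullback d e (etaGr L) ψ) (x : D.E) (y : L.E) (h : φ.onE x = Sum.inl y) :
      ψ.onE x = Sum.inl y := by
    obtain ⟨p, ⟨rfl, rfl⟩, -⟩ := (isPullback_iff.1 hφ).2.2 y x h.symm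
    exact (congr_onE hψ.w p).symm
  have eN : φ.onN = ψ.onN := funext fun x =>
    Option.ext fun y => ⟨onN_le hφ hψ x y, onN_le hψ hφ x y⟩
  refine Grph.Hom.ext' eN (funext fun x => ?_)
  rcases h1 : φ.onE x with y | ⟨a, b⟩
  · exact (onE_le hφ hψ x y h1).symm
  · rcases h2 : ψ.onE x with y | ⟨a', b'⟩
    · rw [onE_le hψ hφ x y h2] at h1
      cases h1
    · have s1 := φ.map_s x
      have s2 := ψ.map_s x
      have t1 := φ.map_t x
      have t2 := ψ.map_t x
      rw [h1] at s1 t1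
      rw [h2, ← eN] at s2 t2
      exact congrArg Sum.inr (Prod.ext (s1.trans s2.symm) (t1.trans t2.symm))

end Grph

/-- `Pol^±` is left adjoint to the underlying-graph functor. -/
def polPMAdjunction : PolPM.{u} ⊣ forgetPol.{u} :=
  Adjunction.mkOfHomEquiv
    { homEquiv := fun X Y =>
        { toFun := fun f => ⟨f.onN, f.onE, f.map_s, f.map_t⟩
          invFun := fun f => ⟨f.onN, f.onE, f.map_s, f.map_t,
            fun n hn => by
              obtain ⟨e, rfl⟩ := hn
              exact Set.mem_of_eq_of_mem (f.map_s e).symm (Y.s_mem _),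
            fun n hn => by
              obtain ⟨e, rfl⟩ := hn
              exact Set.mem_of_eq_of_mem (f.map_t e).symm (Y.t_mem _)⟩
          left_inv := fun _ => rfl
          right_inv := fun _ => rfl }
      homEquiv_naturality_left_symm := fun _ _ => rfl
      homEquiv_naturality_right := fun _ _ => rfl }

theorem IsPullback.map_forgetPol {P X Y Z : PolGrph.{u}} {f : P ⟶ X} {g : P ⟶ Y} {h : X ⟶ Z}
    {k : Y ⟶ Z} (H : IsPullback f g h k) :
    IsPullback (forgetPol.map f) (forgetPol.map g) (forgetPol.map h) (forgetPol.map k) :=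
  have : PreservesLimitsOfSize.{0, 0} forgetPol.{u} := polPMAdjunction.rightAdjoint_preservesLimits
  H.map forgetPol

namespace PolGrph

theorem hom_ext_forget {X Y : PolGrph.{u}} {f g : X ⟶ Y}
    (h : forgetPol.map f = forgetPol.map g) : f = g :=
  PolGrph.Hom.ext' (funext (Grph.congr_onN h)) (funext (Grph.congr_onE h))

/-- A square of polarized graphs whose underlying square is a pullback is a pullback if its
second projection reflects polarities. -/
theorem isPullback_of_forget {P X Y Z : PolGrph.{u}} {f : P ⟶ X} {g : P ⟶ Y} {h : X ⟶ Z}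
    {k : Y ⟶ Z}
    (H : IsPullback (forgetPol.map f) (forgetPol.map g) (forgetPol.map h) (forgetPol.map k))
    (hp : ∀ p, g.onN p ∈ Y.Np → p ∈ P.Np) (hm : ∀ p, g.onN p ∈ Y.Nm → p ∈ P.Nm) :
    IsPullback f g h k := by
  have w : f ≫ h = g ≫ k := hom_ext_forget H.w
  have ws (s : PullbackCone h k) : forgetPol.map s.fst ≫ forgetPol.map h =
      forgetPol.map s.snd ≫ forgetPol.map k := congrArg forgetPol.map s.condition
  refine ⟨⟨w⟩, ⟨PullbackCone.IsLimit.mk w (fun s => ?_) ?_ ?_ ?_⟩⟩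
  · let q := H.lift _ _ (ws s)
    have hq x : g.onN (q.onN x) = s.snd.onN x := Grph.congr_onN (H.lift_snd _ _ (ws s)) x
    exact ⟨q.onN, q.onE, q.map_s, q.map_t,
      fun n hn => hp _ (Set.mem_of_eq_of_mem (hq n) (s.snd.mapNp n hn)),
      fun n hn => hm _ (Set.mem_of_eq_of_mem (hq n) (s.snd.mapNm n hn))⟩
  · exact fun s => hom_ext_forget (H.lift_fst _ _ (ws s))
  · exact fun s => hom_ext_forget (H.lift_snd _ _ (ws s))
  · intro s q h1 h2
    refine hom_ext_forget (H.hom_ext ?_ ?_)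
    · exact (congrArg forgetPol.map h1).trans (H.lift_fst _ _ (ws s)).symm
    · exact (congrArg forgetPol.map h2).trans (H.lift_snd _ _ (ws s)).symm

/-- A single node with prescribed polarities. -/
def point (A B : Set PUnit.{u + 1}) : PolGrph.{u} :=
  ⟨PUnit, PEmpty, PEmpty.elim, PEmpty.elim, A, B, fun e => e.elim, fun e => e.elim⟩

/-- A node of a base change `e` of `Pol(m)` is the image of a polarized point as soon as its image
under `e` has the polarities of that point. -/
theorem exists_lift_point {K D : PolGrph.{u}} {L G : Grph.{u}} {d : K ⟶ PolF.obj L} {e : K ⟶ D}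
    {m : L ⟶ G} {f : D ⟶ PolF.obj G} (H : IsPullback d e (PolF.map m) f)
    (A B : Set PUnit.{u + 1}) (p : K.N) (hA : ∀ n ∈ A, e.onN p ∈ D.Np)
    (hB : ∀ n ∈ B, e.onN p ∈ D.Nm) : ∃ q : point A B ⟶ K, q.onN PUnit.unit = p := by
  let x : point A B ⟶ PolF.obj L := ⟨fun _ => d.onN p, fun a => a.elim, fun a => a.elim,
    fun a => a.elim, fun _ _ => Set.mem_univ _, fun _ _ => Set.mem_univ _⟩
  let y : point A B ⟶ D := ⟨fun _ => e.onN p, fun a => a.elim, fun a => a.elim,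
    fun a => a.elim, hA, hB⟩
  have w : x ≫ PolF.map m = y ≫ f := PolGrph.Hom.ext'
    (funext fun _ => Grph.congr_onN (congrArg forgetPol.map H.w) p) (funext fun a => a.elim)
  refine ⟨H.lift x y w, ?_⟩
  have H' := (Grph.isPullback_iff.1 (IsPullback.map_forgetPol H))
  exact (H'.2.1 _ _ (Grph.congr_onN H'.1 p)).unique
    ⟨Grph.congr_onN (congrArg forgetPol.map (H.lift_fst x y w)) PUnit.unit,
      Grph.congr_onN (congrArg forgetPol.map (H.lift_snd x y w)) PUnit.unit⟩ ⟨rfl, rfl⟩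

theorem mem_Np_of_isPullback {K D : PolGrph.{u}} {L G : Grph.{u}} {d : K ⟶ PolF.obj L} {e : K ⟶ D}
    {m : L ⟶ G} {f : D ⟶ PolF.obj G} (H : IsPullback d e (PolF.map m) f) (p : K.N)
    (hp : e.onN p ∈ D.Np) : p ∈ K.Np := by
  obtain ⟨q, rfl⟩ := exists_lift_point H Set.univ ∅ p (fun _ _ => hp) (fun _ h => h.elim)
  exact q.mapNp _ (Set.mem_univ _)

theorem mem_Nm_of_isPullback {K D : PolGrph.{u}} {L G : Grph.{u}} {d : K ⟶ PolF.obj L} {e : K ⟶ D}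
    {m : L ⟶ G} {f : D ⟶ PolF.obj G} (H : IsPullback d e (PolF.map m) f) (p : K.N)
    (hp : e.onN p ∈ D.Nm) : p ∈ K.Nm := by
  obtain ⟨q, rfl⟩ := exists_lift_point H ∅ Set.univ p (fun _ h => h.elim) (fun _ _ => hp)
  exact q.mapNm _ (Set.mem_univ _)

theorem some_mem_Np {K : PolGrph.{u}} {x : K.N} (h : some x ∈ (TPolObj K).Np) : x ∈ K.Np := by
  obtain h | ⟨y, hy, h⟩ := h
  · cases h
  · exact Option.some.inj h ▸ hy

theorem some_mem_Nm {K : PolGrph.{u}} {x : K.N} (h : some x ∈ (TPolObj K).Nm) : x ∈ K.Nm := by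
  obtain h | ⟨y, hy, h⟩ := h
  · cases h
  · exact Option.some.inj h ▸ hy

theorem exists_map_val {α : Type u} {A : Set α} {z : Option α} (h : z ∈ insert none (some '' A)) :
    ∃ a : Option A, Option.map Subtype.val a = z := by
  rcases h with rfl | ⟨x, hx, rfl⟩
  · exact ⟨none, rfl⟩
  · exact ⟨some ⟨x, hx⟩, rfl⟩

/-- Every strict partial map of polarized graphs has a classifying arrow. -/
theorem exists_classifier {K K' D : PolGrph.{u}} (h : K' ⟶ K) (e : K' ⟶ D)
    (iN : Function.Injective e.onN) (iE : Function.Injective e.onE)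
    (hp : ∀ p, e.onN p ∈ D.Np → p ∈ K'.Np) (hm : ∀ p, e.onN p ∈ D.Nm → p ∈ K'.Nm) :
    ∃ φ : D ⟶ TPolObj K, IsPullback h e (etaPol K) φ := by
  have cN (x : D.N) : ∃ z : Option K.N, (∀ p, e.onN p = x → z = some (h.onN p)) ∧
      ((¬ ∃ p, e.onN p = x) → z = none) := by
    by_cases hx : ∃ p, e.onN p = x
    · obtain ⟨p, rfl⟩ := hx
      exact ⟨some (h.onN p), fun q hq => by rw [iN hq], fun H => (H ⟨p, rfl⟩).elim⟩
    · exact ⟨none, fun p hp => (hx ⟨p, hp⟩).elim, fun _ => rfl⟩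
  choose F hF hF' using cN
  have F_Np (x : D.N) (hx : x ∈ D.Np) : F x ∈ (TPolObj K).Np := by
    by_cases h' : ∃ p, e.onN p = x
    · obtain ⟨p, rfl⟩ := h'
      rw [hF _ p rfl]
      exact (etaPol K).mapNp _ (h.mapNp _ (hp p hx))
    · rw [hF' _ h']
      exact Set.mem_insert _ _
  have F_Nm (x : D.N) (hx : x ∈ D.Nm) : F x ∈ (TPolObj K).Nm := by
    by_cases h' : ∃ p, e.onN p = x
    · obtain ⟨p, rfl⟩ := h'
      rw [hF _ p rfl]
      exact (etaPol K).mapNm _ (h.mapNm _ (hm p hx))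
    · rw [hF' _ h']
      exact Set.mem_insert _ _
  have cE (x : D.E) : ∃ z : (TPolObj K).E, (TPolObj K).s z = F (D.s x) ∧
      (TPolObj K).t z = F (D.t x) ∧ (∀ p, e.onE p = x → z = Sum.inl (h.onE p)) ∧
      ((¬ ∃ p, e.onE p = x) → ∃ w, z = Sum.inr w) := by
    by_cases hx : ∃ p, e.onE p = x
    · obtain ⟨p, rfl⟩ := hx
      refine ⟨Sum.inl (h.onE p), ?_, ?_, fun q hq => by rw [iE hq], fun H => (H ⟨p, rfl⟩).elim⟩
      · rw [hF _ (K'.s p) (e.map_s p).symm, ← h.map_s]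
        rfl
      · rw [hF _ (K'.t p) (e.map_t p).symm, ← h.map_t]
        rfl
    · obtain ⟨a, ha⟩ := exists_map_val (F_Np _ (D.s_mem x))
      obtain ⟨b, hb⟩ := exists_map_val (F_Nm _ (D.t_mem x))
      exact ⟨Sum.inr (a, b), ha, hb, fun p hp => (hx ⟨p, hp⟩).elim, fun _ => ⟨_, rfl⟩⟩
  choose Q hs ht hQ hQ' using cE
  refine ⟨⟨F, Q, hs, ht, F_Np, F_Nm⟩, isPullback_of_forget (Grph.isPullback_iff.2 ⟨?_, ?_, ?_⟩)
    hp hm⟩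
  · exact Grph.Hom.ext' (funext fun p => (hF _ p rfl).symm) (funext fun p => (hQ _ p rfl).symm)
  · intro x y (hxy : some x = F y)
    by_cases h' : ∃ p, e.onN p = y
    · obtain ⟨p, rfl⟩ := h'
      exact ⟨p, ⟨(Option.some.inj (hxy.trans (hF _ p rfl))).symm, rfl⟩, fun q hq => iN hq.2⟩
    · rw [hF' _ h'] at hxy
      cases hxy
  · intro x y (hxy : Sum.inl x = Q y)
    by_cases h' : ∃ p, e.onE p = y
    · obtain ⟨p, rfl⟩ := h'
      exact ⟨p, ⟨(Sum.inl.inj (hxy.trans (hQ _ p rfl))).symm, rfl⟩, fun q hq => iE hq.2⟩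
    · obtain ⟨w, hw⟩ := hQ' _ h'
      rw [hw] at hxy
      cases hxy

/-- The extension `φ(t, l) : |𝕋(K̂)| ⟶ T(L)` of a morphism `l : K ⟶ L`. -/
def extend (K : PolGrph.{u}) {L : Grph.{u}} (l : forgetPol.obj K ⟶ L) :
    forgetPol.obj (TPolObj K) ⟶ TGr.obj L where
  onN := Option.map l.onN
  onE := Sum.map l.onE (Prod.map (Option.map fun x => l.onN x.1) (Option.map fun x => l.onN x.1))
  map_s := by
    rintro (e | ⟨_ | a, b⟩)
    · exact congrArg some (l.map_s e)
    · rfl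
    · rfl
  map_t := by
    rintro (e | ⟨a, _ | b⟩)
    · exact congrArg some (l.map_t e)
    · rfl
    · rfl

theorem isPullback_extend (K : PolGrph.{u}) {L : Grph.{u}} (l : forgetPol.obj K ⟶ L) :
    IsPullback l (forgetPol.map (etaPol K)) (etaGr L) (extend K l) := by
  refine Grph.isPullback_iff.2 ⟨rfl, ?_, ?_⟩
  · rintro x (_ | y) hxy
    · cases hxy
    · exact ⟨y, ⟨(Option.some.inj hxy).symm, rfl⟩, fun q hq => Option.some.inj hq.2⟩
  · rintro x (y | y) hxy
    · exact ⟨y, ⟨(Sum.inl.inj hxy).symm, rfl⟩, fun q hq => Sum.inl.inj hq.2⟩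
    · cases hxy

/-- A strict partial map of polarized graphs has at most one classifying arrow. -/
theorem classifier_unique {K K' D : PolGrph.{u}} {h : K' ⟶ K} {e : K' ⟶ D} {φ ψ : D ⟶ TPolObj K}
    (hφ : IsPullback h e (etaPol K) φ) (hψ : IsPullback h e (etaPol K) ψ) : φ = ψ := by
  have key := Grph.classifier_unique
    ((IsPullback.map_forgetPol hφ).paste_horiz (isPullback_extend K (𝟙 _)))
    ((IsPullback.map_forgetPol hψ).paste_horiz (isPullback_extend K (𝟙 _)))
  have iN : Function.Injective (extend K (𝟙 _)).onN := Option.map_injective fun _ _ h => h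
  have iE : Function.Injective (extend K (𝟙 _)).onE :=
    Sum.map_injective.2 ⟨fun _ _ h => h, (Option.map_injective Subtype.val_injective).prodMap
      (Option.map_injective Subtype.val_injective)⟩
  exact PolGrph.Hom.ext' (funext fun x => iN (Grph.congr_onN key x))
    (funext fun x => iE (Grph.congr_onE key x))

end PolGrph

/-- A mono of graphs, as a partial map with identity codomain part, has a classifying arrow. -/
theorem Grph.exists_classifier_mono {L G : Grph.{u}} (m : L ⟶ G) [Mono m] :
    ∃ mbar : G ⟶ TGr.obj L, IsPullback (𝟙 L) m (etaGr L) mbar := by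
  obtain ⟨φ, hφ⟩ := PolGrph.exists_classifier (𝟙 (PolF.obj L)) (PolF.map m)
    (Grph.onN_injective m) (Grph.onE_injective m) (fun _ _ => Set.mem_univ _)
    (fun _ _ => Set.mem_univ _)
  exact ⟨_, (IsPullback.map_forgetPol hφ).paste_horiz
    (PolGrph.isPullback_extend (PolF.obj L) (𝟙 L))⟩

/-- The polarities induced on a graph over `|X̂|`. -/
def PolGrph.induced (X : PolGrph.{u}) {D : Grph.{u}} (f : D ⟶ forgetPol.obj X) : PolGrph.{u} where
  N := D.N
  E := D.E
  s := D.s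
  t := D.t
  Np := f.onN ⁻¹' X.Np
  Nm := f.onN ⁻¹' X.Nm
  s_mem e := Set.mem_preimage.2 (Set.mem_of_eq_of_mem (f.map_s e).symm (X.s_mem _))
  t_mem e := Set.mem_preimage.2 (Set.mem_of_eq_of_mem (f.map_t e).symm (X.t_mem _))

/-- The pullback object of an AGREE step is the pullback complement of the match. -/
theorem Grph.isPullback_agree {K L TK D G : Grph.{u}} {l : K ⟶ L} {t : K ⟶ TK} {m : L ⟶ G}
    {l' : TK ⟶ TGr.obj L} {mbar : G ⟶ TGr.obj L} {g : D ⟶ G} {n' : D ⟶ TK} {n : K ⟶ D}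
    (hl : IsPullback l t (etaGr L) l') (hmb : IsPullback (𝟙 L) m (etaGr L) mbar)
    (hD : IsPullback g n' mbar l') (hn' : n ≫ n' = t) (hg : n ≫ g = l ≫ m) :
    IsPullback l n m g := by
  subst hn'
  obtain ⟨-, lN, lE⟩ := Grph.isPullback_iff.1 hl
  obtain ⟨wD, DN, DE⟩ := Grph.isPullback_iff.1 hD
  refine Grph.isPullback_iff.2 ⟨hg.symm, fun x y hxy => ?_, fun x y hxy => ?_⟩
  · obtain ⟨k, ⟨rfl, hk⟩, uk⟩ := lN x (n'.onN y) 
      ((Grph.congr_onN hmb.w x).trans ((congrArg mbar.onN hxy).trans (Grph.congr_onN wD y)))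
    refine ⟨k, ⟨rfl, ?_⟩, fun q hq => uk q ⟨hq.1, congrArg n'.onN hq.2⟩⟩
    exact (DN _ _ (Grph.congr_onN wD y)).unique ⟨(Grph.congr_onN hg k).trans hxy, hk⟩ ⟨rfl, rfl⟩
  · obtain ⟨k, ⟨rfl, hk⟩, uk⟩ := lE x (n'.onE y) 
      ((Grph.congr_onE hmb.w x).trans ((congrArg mbar.onE hxy).trans (Grph.congr_onE wD y)))
    refine ⟨k, ⟨rfl, ?_⟩, fun q hq => uk q ⟨hq.1, congrArg n'.onE hq.2⟩⟩
    exact (DE _ _ (Grph.congr_onE wD y)).unique ⟨(Grph.congr_onE hg k).trans hxy, hk⟩ ⟨rfl, rfl⟩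

/-- The pullback object of the AGREE step for `|η_{K̂}|` underlies a final pullback complement
of polarized graphs. -/
theorem exists_finalPullbackComplement_of_agree (Khat : PolGrph.{u}) {L G D : Grph.{u}}
    {l : forgetPol.obj Khat ⟶ L} {m : L ⟶ G} [Mono m]
    {l' : forgetPol.obj (TPolObj Khat) ⟶ TGr.obj L} {mbar : G ⟶ TGr.obj L} {g : D ⟶ G}
    {n' : D ⟶ forgetPol.obj (TPolObj Khat)} {n : forgetPol.obj Khat ⟶ D}
    (hl : IsPullback l (forgetPol.map (etaPol Khat)) (etaGr L) l')
    (hmb : IsPullback (𝟙 L) m (etaGr L) mbar) (hD : IsPullback g n' mbar l')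
    (hn' : n ≫ n' = forgetPol.map (etaPol Khat)) (hg : n ≫ g = l ≫ m) :
    ∃ (nhat : Khat ⟶ (TPolObj Khat).induced n') (ghat : (TPolObj Khat).induced n' ⟶ PolF.obj G),
      forgetPol.map nhat = n ∧
      IsFinalPullbackComplement (polUnit Khat ≫ PolF.map l) (PolF.map m) nhat ghat := by
  have hn (x : Khat.N) : n'.onN (n.onN x) = some x := Grph.congr_onN hn' x
  let nhat : Khat ⟶ (TPolObj Khat).induced n' := ⟨n.onN, n.onE, n.map_s, n.map_t,
    fun x hx => Set.mem_preimage.2 (Set.mem_of_eq_of_mem (hn x) ((etaPol Khat).mapNp x hx)),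
    fun x hx => Set.mem_preimage.2 (Set.mem_of_eq_of_mem (hn x) ((etaPol Khat).mapNm x hx))⟩
  let ghat : (TPolObj Khat).induced n' ⟶ PolF.obj G := ⟨g.onN, g.onE, g.map_s, g.map_t,
    fun _ _ => Set.mem_univ _, fun _ _ => Set.mem_univ _⟩
  let nhat' : (TPolObj Khat).induced n' ⟶ TPolObj Khat :=
    ⟨n'.onN, n'.onE, n'.map_s, n'.map_t, fun _ h => h, fun _ h => h⟩
  have hp (x : Khat.N) (hx : nhat.onN x ∈ ((TPolObj Khat).induced n').Np) : x ∈ Khat.Np :=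
    PolGrph.some_mem_Np (Set.mem_of_eq_of_mem (hn x).symm hx)
  have hm (x : Khat.N) (hx : nhat.onN x ∈ ((TPolObj Khat).induced n').Nm) : x ∈ Khat.Nm :=
    PolGrph.some_mem_Nm (Set.mem_of_eq_of_mem (hn x).symm hx)
  have compl : IsPullback l n m g := Grph.isPullback_agree hl hmb hD hn' hg
  have complPol : IsPullback (polUnit Khat ≫ PolF.map l) nhat (PolF.map m) ghat :=
    PolGrph.isPullback_of_forget compl hp hm
  have unitGr : IsPullback (𝟙 _) n (forgetPol.map (etaPol Khat)) n' := by
    refine IsPullback.of_right ?_ (by rw [Category.id_comp, hn']) hl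
    have := compl.paste_horiz hmb
    rwa [Category.comp_id, hD.w, ← Category.id_comp l] at this
  have unitPol : IsPullback (𝟙 Khat) nhat (etaPol Khat) nhat' :=
    PolGrph.isPullback_of_forget unitGr hp hm
  refine ⟨nhat, ghat, rfl, complPol, ?_⟩
  rintro K' D' d e f h hpb rfl
  have hpbGr := IsPullback.map_forgetPol hpb
  have : Mono (forgetPol.map (PolF.map m)) := ‹Mono m›
  have : Mono (forgetPol.map e) := ⟨fun a b hab => hpbGr.hom_ext
    ((cancel_mono (forgetPol.map (PolF.map m))).1 (by
      rw [Category.assoc, Category.assoc, hpbGr.w, reassoc_of% hab])) hab⟩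
  obtain ⟨φ, hφ⟩ := PolGrph.exists_classifier h e (Grph.onN_injective (forgetPol.map e))
    (Grph.onE_injective (forgetPol.map e)) (PolGrph.mem_Np_of_isPullback hpb)
    (PolGrph.mem_Nm_of_isPullback hpb)
  have w : forgetPol.map f ≫ mbar = forgetPol.map φ ≫ l' :=
    Grph.classifier_unique (hpbGr.paste_horiz hmb)
      ((IsPullback.map_forgetPol hφ).paste_horiz hl)
  let q := hD.lift _ _ w
  have q_snd (x : D'.N) : n'.onN (q.onN x) = φ.onN x := Grph.congr_onN (hD.lift_snd _ _ w) x
  let qhat : D' ⟶ (TPolObj Khat).induced n' := ⟨q.onN, q.onE, q.map_s, q.map_t,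
    fun x hx => Set.mem_preimage.2 (Set.mem_of_eq_of_mem (q_snd x) (φ.mapNp x hx)),
    fun x hx => Set.mem_preimage.2 (Set.mem_of_eq_of_mem (q_snd x) (φ.mapNm x hx))⟩
  refine ⟨qhat, ⟨PolGrph.hom_ext_forget (hD.lift_fst _ _ w), PolGrph.hom_ext_forget ?_⟩, ?_⟩
  · change forgetPol.map e ≫ q = forgetPol.map h ≫ n
    refine hD.hom_ext ?_ ?_
    · rw [Category.assoc, show q ≫ g = _ from hD.lift_fst _ _ w, Category.assoc, hg]
      exact hpbGr.w.symm
    · rw [Category.assoc, show q ≫ n' = _ from hD.lift_snd _ _ w, Category.assoc, hn']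
      exact (IsPullback.map_forgetPol hφ).w.symm
  · rintro q' ⟨rfl, h2⟩
    refine PolGrph.hom_ext_forget (hD.hom_ext ?_ ?_)
    · exact (hD.lift_fst _ _ w).symm
    · have h3 : IsPullback h e nhat q' := IsPullback.of_right hpb h2.symm complPol
      have h4 := h3.paste_horiz unitPol
      rw [Category.comp_id] at h4
      exact (congrArg forgetPol.map (PolGrph.classifier_unique h4 hφ)).trans
        (hD.lift_snd _ _ w).symm

/-- Final pullback complements are unique up to isomorphism. -/
theorem IsFinalPullbackComplement.exists_iso {C : Type w} [Category.{v} C] {K L D D' G : C}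
    {l : K ⟶ L} {m : L ⟶ G} {n : K ⟶ D} {a : D ⟶ G} {n' : K ⟶ D'} {a' : D' ⟶ G}
    (h : IsFinalPullbackComplement l m n a) (h' : IsFinalPullbackComplement l m n' a') :
    ∃ i : D ≅ D', n ≫ i.hom = n' := by
  obtain ⟨f, ⟨f1, f2⟩, -⟩ := h'.2 l n a (𝟙 K) h.1 (Category.id_comp l)
  obtain ⟨b, ⟨b1, b2⟩, -⟩ := h.2 l n' a' (𝟙 K) h'.1 (Category.id_comp l)
  rw [Category.id_comp] at f2 b2
  refine ⟨⟨f, b, ?_, ?_⟩, f2⟩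
  · exact (h.2 l n a (𝟙 K) h.1 (Category.id_comp l)).unique
      ⟨by rw [Category.assoc, b1, f1], by rw [reassoc_of% f2, b2, Category.id_comp]⟩
      ⟨Category.id_comp a, by rw [Category.comp_id, Category.id_comp]⟩
  · exact (h'.2 l n' a' (𝟙 K) h'.1 (Category.id_comp l)).unique
      ⟨by rw [Category.assoc, f1, b1], by rw [reassoc_of% b2, f2, Category.id_comp]⟩
      ⟨Category.id_comp a', by rw [Category.comp_id, Category.id_comp]⟩

/-- AGREE subsumes polarized node cloning on graphs: for a PSqPO rule
`ρ = ((l, r), K̂)` and a monic match `m : L ↣ G`, setting `T_K = |𝕋(K̂)|` and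
`t = |η_{K̂}| : K ⟶ T_K`, we have `G ⇒_{ρ,m}^{PSqPO} H` iff
`G ⇒_{(l,r,t),m}^{AGREE} H` in `Gr`. -/
theorem psqpo_iff_agree (Khat : PolGrph.{u}) {L R G H : Grph.{u}}
    (l : forgetPol.obj Khat ⟶ L) (r : forgetPol.obj Khat ⟶ R)
    (m : L ⟶ G) (hm : Mono m) :
    PSqpoStep Khat l r m H ↔
      AgreeStepGr l r (forgetPol.map (etaPol Khat)) m H := by
  constructor
  · rintro ⟨Dhat, n, g, h, p, hfpc, hpo⟩
    obtain ⟨mbar, hmb⟩ := Grph.exists_classifier_mono m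
    have hl := PolGrph.isPullback_extend Khat l
    obtain ⟨D, g₀, n', hD⟩ := Grph.exists_isPullback mbar (PolGrph.extend Khat l)
    have w : (l ≫ m) ≫ mbar = forgetPol.map (etaPol Khat) ≫ PolGrph.extend Khat l := by
      rw [Category.assoc, ← hmb.w, Category.id_comp, hl.w]
    obtain ⟨nhat, ghat, hn, hfpc'⟩ := exists_finalPullbackComplement_of_agree Khat hl hmb hD
      (hD.lift_snd _ _ w) (hD.lift_fst _ _ w)
    obtain ⟨i, hi⟩ := hfpc'.exists_iso hfpc
    have hpo' : IsPushout (forgetPol.map nhat) r (forgetPol.map i.hom ≫ h) p := by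
      refine IsPushout.of_iso hpo (Iso.refl _) (forgetPol.mapIso i).symm (Iso.refl _) (Iso.refl _)
        ?_ ?_ ?_ ?_
      · rw [Iso.symm_hom, Functor.mapIso_inv, ← forgetPol.map_comp, ← hi, Category.assoc,
          i.hom_inv_id, Category.comp_id, Iso.refl_hom, Category.id_comp]
      · simp
      · rw [Iso.symm_hom, Functor.mapIso_inv, Iso.refl_hom, Category.comp_id, ← Category.assoc,
          ← forgetPol.map_comp, i.inv_hom_id, forgetPol.map_id, Category.id_comp]
      · simp
    rw [hn] at hpo'
    exact ⟨_, mbar, hl, hmb, D, g₀, n', hD.lift _ _ w, forgetPol.map i.hom ≫ h, p, hD,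
      hD.lift_snd _ _ w, hD.lift_fst _ _ w, hpo'⟩
  · rintro ⟨l', mbar, hl, hmb, D, g, n', n, h, p, hD, hn', hg, hpo⟩
    obtain ⟨nhat, ghat, rfl, hfpc⟩ :=
      exists_finalPullbackComplement_of_agree Khat hl hmb hD hn' hg
    exact ⟨_, nhat, ghat, h, p, hfpc, hpo⟩
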